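/- Let X be a separable real Banach space with Property(M). If c₀ does not embed isomorphically into X, then X has a Kadec-Klee norm. -/

import Mathlib

open Filter Topology ZeroAtInfty

/-- A sequence converges weakly to zero. -/
def WeakNull {E : Type*} [NormedAddCommGroup E] [NormedSpace ℝ E] (x : ℕ → E) : Prop :=
  ∀ f : E →L[ℝ] ℝ, Tendsto (fun n => f (x n)) atTop (nhds 0)

/-- Property (M). -/
def PropertyM (E : Type*) [NormedAddCommGroup E] [NormedSpace ℝ E] : Prop :=
  ∀ x : ℕ → E, WeakNull x → ∀ u v : E, ‖u‖ ≤ ‖v‖ →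
    Filter.limsup (fun n => ‖x n + u‖) atTop ≤ Filter.limsup (fun n => ‖x n + v‖) atTop

/-- `F` embeds isomorphically into `E`. -/
def EmbedsIso (F E : Type*) [NormedAddCommGroup F] [NormedSpace ℝ F]
    [NormedAddCommGroup E] [NormedSpace ℝ E] : Prop :=
  ∃ T : F →L[ℝ] E, Function.Injective T ∧ ∃ c > (0 : ℝ), ∀ y, c * ‖y‖ ≤ ‖T y‖

/-- Weak normal structure. -/
def WeakNormalStructure (E : Type*) [NormedAddCommGroup E] [NormedSpace ℝ E] : Prop :=
  ∀ C : Set E, Convex ℝ C → IsCompact (toWeakSpace ℝ E '' C) → C.Nontrivial →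
    ∃ x ∈ C, sSup ((fun y => ‖x - y‖) '' C) < Metric.diam C

/-- Property (K). -/
def PropertyK (E : Type*) [NormedAddCommGroup E] [NormedSpace ℝ E] : Prop :=
  ∃ K : ℝ, 0 ≤ K ∧ K < 1 ∧ ∀ (x : ℕ → E) (y : E), WeakNull x →
    Tendsto (fun n => ‖x n‖) atTop (nhds 1) →
    Filter.liminf (fun n => ‖x n - y‖) atTop ≤ 1 → ‖y‖ ≤ K

/-- Kadec-Klee norm. -/
def KadecKlee (E : Type*) [NormedAddCommGroup E] [NormedSpace ℝ E] : Prop :=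
  ∀ (x : ℕ → E) (y : E),
    (∀ f : E →L[ℝ] ℝ, Tendsto (fun n => f (x n)) atTop (nhds (f y))) →
    Tendsto (fun n => ‖x n‖) atTop (nhds ‖y‖) →
    Tendsto (fun n => ‖x n - y‖) atTop (nhds 0)

/-- Opial's modulus. -/
noncomputable def opialModulus (E : Type*) [NormedAddCommGroup E] [NormedSpace ℝ E]
    (c : ℝ) : ℝ :=
  sInf { r : ℝ | ∃ (x : ℕ → E) (y : E), c ≤ ‖y‖ ∧ WeakNull x ∧
    1 ≤ Filter.liminf (fun n => ‖x n‖) atTop ∧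
    r = Filter.liminf (fun n => ‖x n - y‖) atTop - 1 }

/-- A sequence of functionals converges weak-star to zero. -/
def WeakStarNull {E : Type*} [NormedAddCommGroup E] [NormedSpace ℝ E]
    (f : ℕ → (E →L[ℝ] ℝ)) : Prop :=
  ∀ x : E, Tendsto (fun n => f n x) atTop (nhds 0)

/-- Property (M*) of the dual. -/
def PropertyMStar (E : Type*) [NormedAddCommGroup E] [NormedSpace ℝ E] : Prop :=
  ∀ f : ℕ → (E →L[ℝ] ℝ), WeakStarNull f → ∀ u v : E →L[ℝ] ℝ, ‖u‖ ≤ ‖v‖ →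
    Filter.limsup (fun n => ‖f n + u‖) atTop ≤ Filter.limsup (fun n => ‖f n + v‖) atTop

/-- Property (K*) of the dual. -/
def PropertyKStar (E : Type*) [NormedAddCommGroup E] [NormedSpace ℝ E] : Prop :=
  ∃ K : ℝ, 0 ≤ K ∧ K < 1 ∧ ∀ (f : ℕ → (E →L[ℝ] ℝ)) (g : E →L[ℝ] ℝ), WeakStarNull f →
    Tendsto (fun n => ‖f n‖) atTop (nhds 1) →
    Filter.liminf (fun n => ‖f n - g‖) atTop ≤ 1 → ‖g‖ ≤ K

/-- weak* Kadec-Klee norm on the dual. -/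
def WeakStarKadecKlee (E : Type*) [NormedAddCommGroup E] [NormedSpace ℝ E] : Prop :=
  ∀ (f : ℕ → (E →L[ℝ] ℝ)) (g : E →L[ℝ] ℝ),
    (∀ x : E, Tendsto (fun n => f n x) atTop (nhds (g x))) →
    Tendsto (fun n => ‖f n‖) atTop (nhds ‖g‖) →
    Tendsto (fun n => ‖f n - g‖) atTop (nhds 0)

/-- weak* Opial modulus of the dual. -/
noncomputable def weakStarOpialModulus (E : Type*) [NormedAddCommGroup E] [NormedSpace ℝ E]
    (c : ℝ) : ℝ :=
  sInf { r : ℝ | ∃ (f : ℕ → (E →L[ℝ] ℝ)) (g : E →L[ℝ] ℝ), c ≤ ‖g‖ ∧ WeakStarNull f ∧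
    1 ≤ Filter.liminf (fun n => ‖f n‖) atTop ∧
    r = Filter.liminf (fun n => ‖f n - g‖) atTop - 1 }

/-- WORTH* for the dual. -/
def WORTHStar (E : Type*) [NormedAddCommGroup E] [NormedSpace ℝ E] : Prop :=
  ∀ f : ℕ → (E →L[ℝ] ℝ), WeakStarNull f → ∀ g : E →L[ℝ] ℝ,
    Tendsto (fun n => ‖f n - g‖ - ‖f n + g‖) atTop (nhds 0)

/-- Reflexivity of a normed space. -/
def IsReflexive (E : Type*) [NormedAddCommGroup E] [NormedSpace ℝ E] : Prop :=
  Function.Surjective (NormedSpace.inclusionInDoubleDual ℝ E)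

/-- The fixed point property for nonexpansive maps. -/
def FPP (E : Type*) [NormedAddCommGroup E] [NormedSpace ℝ E] : Prop :=
  ∀ C : Set E, C.Nonempty → IsClosed C → Bornology.IsBounded C → Convex ℝ C →
    ∀ T : E → E, Set.MapsTo T C C →
      (∀ x ∈ C, ∀ y ∈ C, ‖T x - T y‖ ≤ ‖x - y‖) → ∃ x ∈ C, T x = x

/-- `E` contains an asymptotically isometric copy of `c₀`. -/
def ContainsAsympIsoC0 (E : Type*) [NormedAddCommGroup E] [NormedSpace ℝ E] : Prop :=
  ∃ ε : ℕ → ℝ, (∀ n, ε n ∈ Set.Ioo (0 : ℝ) 1) ∧ Tendsto ε atTop (nhds 0) ∧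
    ∃ x : ℕ → E, ∀ t : ℕ →₀ ℝ,
      (∀ n, (1 - ε n) * |t n| ≤ ‖∑ n ∈ t.support, t n • x n‖) ∧
      ‖∑ n ∈ t.support, t n • x n‖ ≤ ⨆ n, |t n|

/-- `E` contains an asymptotically isometric copy of `ℓ₁`. -/
def ContainsAsympIsoL1 (E : Type*) [NormedAddCommGroup E] [NormedSpace ℝ E] : Prop :=
  ∃ ε : ℕ → ℝ, (∀ n, ε n ∈ Set.Ioo (0 : ℝ) 1) ∧ Tendsto ε atTop (nhds 0) ∧
    ∃ x : ℕ → E, ∀ t : ℕ →₀ ℝ,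
      (∑ n ∈ t.support, (1 - ε n) * |t n| ≤ ‖∑ n ∈ t.support, t n • x n‖) ∧
      ‖∑ n ∈ t.support, t n • x n‖ ≤ ∑ n ∈ t.support, |t n|


/-- The finitely many signed sums of terms of `z` with distinct indices below `N`. -/
def signedSums {G : Type*} [AddCommGroup G] (z : ℕ → G) : ℕ → Set G
  | 0 => {0}
  | N + 1 => signedSums z N ∪ ((fun u => z N + u) '' signedSums z N ∪
      (fun u => -z N + u) '' signedSums z N)

lemma finite_signedSums {G : Type*} [AddCommGroup G] (z : ℕ → G) (N : ℕ) :
    (signedSums z N).Finite := by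
  induction N with
  | zero => exact Set.finite_singleton 0
  | succ N ih => exact ih.union ((ih.image _).union (ih.image _))

lemma monotone_signedSums {G : Type*} [AddCommGroup G] (z : ℕ → G) : Monotone (signedSums z) :=
  monotone_nat_of_le_succ fun _ => Set.subset_union_left

lemma zero_mem_signedSums {G : Type*} [AddCommGroup G] (z : ℕ → G) (N : ℕ) :
    (0 : G) ∈ signedSums z N :=
  monotone_signedSums z (Nat.zero_le N) rfl

section

variable {X : Type*} [NormedAddCommGroup X] [NormedSpace ℝ X]

lemma sum_abs_dual_apply_le_of_sign_sums {w : ℕ → X} {C : ℝ}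
    (hw : ∀ (s : ℕ → ℝ), (∀ i, s i = 1 ∨ s i = -1) →
      ∀ k, ‖∑ i ∈ Finset.range k, s i • w i‖ ≤ C)
    {f : X →L[ℝ] ℝ} (hf : ‖f‖ ≤ 1) (F : Finset ℕ) : ∑ i ∈ F, |f (w i)| ≤ C := by
  obtain ⟨k, hk⟩ := F.exists_nat_subset_range
  let s : ℕ → ℝ := fun i => if 0 ≤ f (w i) then 1 else -1
  have hs : ∀ i, s i = 1 ∨ s i = -1 := fun i => by by_cases h : 0 ≤ f (w i) <;> simp [s, h]
  have habs : ∀ i, |f (w i)| = s i * f (w i) := fun i => by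
    by_cases h : 0 ≤ f (w i)
    · simp [s, h, abs_of_nonneg h]
    · simp [s, h, abs_of_neg (not_le.1 h)]
  calc ∑ i ∈ F, |f (w i)| ≤ ∑ i ∈ Finset.range k, |f (w i)| :=
        Finset.sum_le_sum_of_subset_of_nonneg hk fun _ _ _ => abs_nonneg _
    _ = f (∑ i ∈ Finset.range k, s i • w i) := by simp [map_sum, habs]
    _ ≤ ‖f‖ * ‖∑ i ∈ Finset.range k, s i • w i‖ := (le_abs_self _).trans (f.le_opNorm _)
    _ ≤ 1 * ‖∑ i ∈ Finset.range k, s i • w i‖ := by gcongr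
    _ ≤ C := by simpa using hw s hs k

lemma norm_sum_smul_le_of_sign_sums {w : ℕ → X} {C : ℝ}
    (hw : ∀ (s : ℕ → ℝ), (∀ i, s i = 1 ∨ s i = -1) →
      ∀ k, ‖∑ i ∈ Finset.range k, s i • w i‖ ≤ C)
    (t : ℕ → ℝ) (F : Finset ℕ) {b : ℝ} (hb : 0 ≤ b) (ht : ∀ i ∈ F, |t i| ≤ b) :
    ‖∑ i ∈ F, t i • w i‖ ≤ C * b := by
  obtain ⟨f, hf, hfx⟩ := exists_dual_vector'' ℝ (∑ i ∈ F, t i • w i)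
  have hfx' : f (∑ i ∈ F, t i • w i) = ‖∑ i ∈ F, t i • w i‖ := by simpa using hfx
  rw [← hfx', map_sum]
  calc ∑ i ∈ F, f (t i • w i) ≤ ∑ i ∈ F, b * |f (w i)| := by
        refine Finset.sum_le_sum fun i hi => ?_
        rw [map_smul, smul_eq_mul]
        refine (le_abs_self _).trans ?_
        rw [abs_mul]
        exact mul_le_mul_of_nonneg_right (ht i hi) (abs_nonneg _)
    _ = b * ∑ i ∈ F, |f (w i)| := by rw [Finset.mul_sum]
    _ ≤ b * C := by gcongr; exact sum_abs_dual_apply_le_of_sign_sums hw hf F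
    _ = C * b := mul_comm _ _

lemma ZeroAtInftyContinuousMap.abs_apply_le_norm (t : C₀(ℕ, ℝ)) (i : ℕ) : |t i| ≤ ‖t‖ :=
  t.toBCF.norm_coe_le_norm i

lemma summable_smul_of_sign_sums [CompleteSpace X] {w : ℕ → X} {C : ℝ}
    (hw : ∀ (s : ℕ → ℝ), (∀ i, s i = 1 ∨ s i = -1) →
      ∀ k, ‖∑ i ∈ Finset.range k, s i • w i‖ ≤ C)
    (t : C₀(ℕ, ℝ)) : Summable fun i => t i • w i := by
  have hC : 0 ≤ C := (norm_nonneg _).trans (hw (fun _ => 1) (fun _ => Or.inl rfl) 0)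
  rw [summable_iff_vanishing_norm]
  intro ε hε
  have ht : Tendsto t cofinite (𝓝 0) := by
    simpa [Nat.cofinite_eq_atTop] using t.zero_at_infty'
  have hfin : {i | ¬ |t i| < ε / (C + 1)}.Finite := by
    have := ht.abs.eventually_lt_const (u := ε / (C + 1)) (by simpa using by positivity)
    exact this
  refine ⟨hfin.toFinset, fun F hF => ?_⟩
  refine (norm_sum_smul_le_of_sign_sums hw t F (b := ε / (C + 1)) (by positivity)
    fun i hi => ?_).trans_lt ?_
  · by_contra h
    exact Finset.disjoint_left.1 hF hi (by simpa using (not_le.1 h).le)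
  · rw [mul_div_assoc', div_lt_iff₀ (by positivity)]
    nlinarith

/-- A sequence with bounded sign sums which is almost biorthogonal to a bounded sequence of
functionals spans a copy of `c₀`. -/
lemma embedsIso_c0_of_sign_sums [CompleteSpace X] {w : ℕ → X} {C : ℝ}
    (hw : ∀ (s : ℕ → ℝ), (∀ i, s i = 1 ∨ s i = -1) →
      ∀ k, ‖∑ i ∈ Finset.range k, s i • w i‖ ≤ C)
    {g : ℕ → X →L[ℝ] ℝ} {K δ A : ℝ} {a : ℕ → ℝ} (hK : 0 < K) (hg : ∀ k, ‖g k‖ ≤ K)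
    (hδ : ∀ k, δ ≤ |g k (w k)|) (ha0 : ∀ i, 0 ≤ a i) (ha : HasSum a A) (hAδ : A < δ)
    (hoff : ∀ k i, i ≠ k → |g k (w i)| ≤ a i) : EmbedsIso C₀(ℕ, ℝ) X := by
  have hsum := summable_smul_of_sign_sums hw
  let L : C₀(ℕ, ℝ) →ₗ[ℝ] X :=
    { toFun := fun t => ∑' i, t i • w i
      map_add' := fun t u => by
        rw [← (hsum t).tsum_add (hsum u)]
        simp [add_smul]
      map_smul' := fun c t => by
        simp only [RingHom.id_apply]
        rw [← (hsum t).tsum_const_smul c]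
        simp [mul_smul] }
  have hL : ∀ t, HasSum (fun i => t i • w i) (L t) := fun t => (hsum t).hasSum
  have hbound : ∀ t, ‖L t‖ ≤ C * ‖t‖ := fun t =>
    le_of_tendsto (hL t).norm (Eventually.of_forall fun F =>
      norm_sum_smul_le_of_sign_sums hw t F (norm_nonneg t) fun i _ => t.abs_apply_le_norm i)
  have hlower : ∀ t, (δ - A) / K * ‖t‖ ≤ ‖L t‖ := by
    intro t
    have hA0 : 0 ≤ A := ha.nonneg ha0
    have hδ0 : 0 < δ := hA0.trans_lt hAδ
    have key : ∀ k, δ * |t k| ≤ K * ‖L t‖ + A * ‖t‖ := by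
      intro k
      have h1 : HasSum (fun i => t i * g k (w i)) (g k (L t)) := by
        simpa [Function.comp_def] using (hL t).mapL (g k)
      have h2 := h1.sub (hasSum_ite_eq k (t k * g k (w k)))
      have h3 := h2.norm_le_of_bounded (ha.mul_right ‖t‖) (fun i => by
        by_cases h : i = k
        · subst h; simpa using mul_nonneg (ha0 i) (norm_nonneg t)
        · simp only [h, if_false, sub_zero, Real.norm_eq_abs, abs_mul]
          rw [mul_comm]
          exact mul_le_mul (hoff k i h) (t.abs_apply_le_norm i) (abs_nonneg _) (ha0 i))
      have h4 : |t k * g k (w k)| ≤ |g k (L t)| + A * ‖t‖ := by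
        rw [Real.norm_eq_abs] at h3
        have := abs_sub_abs_le_abs_sub (t k * g k (w k)) (g k (L t))
        rw [abs_sub_comm] at this
        linarith
      have h5 : |g k (L t)| ≤ K * ‖L t‖ := (g k).le_of_opNorm_le (hg k) _
      have h6 : δ * |t k| ≤ |t k * g k (w k)| := by
        rw [abs_mul, mul_comm]
        exact mul_le_mul_of_nonneg_left (hδ k) (abs_nonneg _)
      linarith
    have hnorm : ‖t‖ ≤ (K * ‖L t‖ + A * ‖t‖) / δ := by
      rw [← ZeroAtInftyContinuousMap.norm_toBCF_eq_norm,
        BoundedContinuousFunction.norm_le (by positivity)]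
      intro k
      rw [le_div_iff₀ hδ0, mul_comm]
      exact key k
    rw [le_div_iff₀ hδ0] at hnorm
    rw [div_mul_eq_mul_div, div_le_iff₀ hK]
    linarith
  refine ⟨L.mkContinuous C hbound, ?_, (δ - A) / K, div_pos (sub_pos.2 hAδ) hK, hlower⟩
  refine (injective_iff_map_eq_zero _).2 fun t ht => ?_
  have h := hlower t
  rw [show L t = 0 from ht, norm_zero] at h
  have : 0 < (δ - A) / K := div_pos (sub_pos.2 hAδ) hK
  exact norm_eq_zero.1 (le_antisymm (by nlinarith) (norm_nonneg t))

lemma PropertyM.eventually_norm_add_lt (hM : PropertyM X) {z : ℕ → X} (hz : WeakNull z) {y : X}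
    (hy : y ≠ 0) (hzy : Tendsto (fun n => ‖z n + y‖) atTop (𝓝 ‖y‖)) (u : X) {ε : ℝ}
    (hε : 0 < ε) : ∀ᶠ n in atTop, ‖z n + u‖ < max ‖u‖ ‖y‖ + ε := by
  have hy0 : 0 < ‖y‖ := norm_pos_iff.2 hy
  set m := max ‖u‖ ‖y‖ with hm
  have hmy : ‖y‖ ≤ m := le_max_right _ _
  have hbdd : ∀ v : X, ∀ᶠ n in atTop, ‖z n + v‖ ≤ ‖y‖ + ‖v - y‖ + ε / 2 := fun v => by
    filter_upwards [hzy.eventually_lt_const (show ‖y‖ < ‖y‖ + ε / 2 by linarith)] with n hn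
    have : z n + v = (z n + y) + (v - y) := by abel
    rw [this]
    linarith [norm_add_le (z n + y) (v - y)]
  let v : X := (m / ‖y‖) • y
  have hv : ‖v‖ = m := by
    simp only [v, norm_smul, norm_div, norm_norm, Real.norm_of_nonneg (hy0.le.trans hmy)]
    field_simp
  have hvy : ‖v - y‖ = m - ‖y‖ := by
    have : v - y = (m / ‖y‖ - 1) • y := by simp [v, sub_smul]
    rw [this, norm_smul, Real.norm_of_nonneg (by rw [sub_nonneg, one_le_div hy0]; exact hmy)]
    field_simp
  refine eventually_lt_of_limsup_lt (lt_of_le_of_lt (b := m + ε / 2) ?_ (by linarith))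
    ⟨_, hbdd u⟩
  refine (hM z hz u v (hv ▸ le_max_left _ _)).trans ?_
  refine limsup_le_of_le (isCoboundedUnder_le_of_le _ (x := 0) fun n => norm_nonneg _) ?_
  filter_upwards [hbdd v] with n hn
  linarith

lemma sign_smul_add_mem_signedSums (z : ℕ → X) {N : ℕ} {u : X} (hu : u ∈ signedSums z N) {s : ℝ}
    (hs : s = 1 ∨ s = -1) : s • z N + u ∈ signedSums z (N + 1) := by
  rcases hs with rfl | rfl
  · exact Or.inr (Or.inl ⟨u, hu, by simp⟩)
  · exact Or.inr (Or.inr ⟨u, hu, by simp⟩)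

lemma sum_mem_signedSums (z : ℕ → X) {φ : ℕ → ℕ} (hφ : StrictMono φ) {s : ℕ → ℝ}
    (hs : ∀ i, s i = 1 ∨ s i = -1) (k : ℕ) :
    ∑ i ∈ Finset.range (k + 1), s i • z (φ i) ∈ signedSums z (φ k + 1) := by
  have hstep : ∀ k, ∑ i ∈ Finset.range k, s i • z (φ i) ∈ signedSums z (φ k) := by
    intro k
    induction k with
    | zero => simpa using zero_mem_signedSums z (φ 0)
    | succ k ih =>
      rw [Finset.sum_range_succ, add_comm (∑ _ ∈ _, _)]
      exact monotone_signedSums z (Nat.succ_le_of_lt (hφ k.lt_succ_self))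
        (sign_smul_add_mem_signedSums z ih (hs k))
  rw [Finset.sum_range_succ, add_comm (∑ _ ∈ _, _)]
  exact sign_smul_add_mem_signedSums z (hstep k) (hs k)

lemma norm_sign_sum_le {z : ℕ → X} {R : ℝ} {φ : ℕ → ℕ} (hφ : StrictMono φ) (hR : 0 ≤ R)
    (h : ∀ k, ∀ u ∈ signedSums z (φ k + 1), ∀ s : ℝ, (s = 1 ∨ s = -1) →
      ‖s • z (φ (k + 1)) + u‖ ≤ max ‖u‖ R + (1 / 2) ^ k)
    (s : ℕ → ℝ) (hs : ∀ i, s i = 1 ∨ s i = -1) (k : ℕ) :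
    ‖∑ i ∈ Finset.range k, s i • z (φ i)‖ ≤ ‖z (φ 0)‖ + R + 2 := by
  cases k with
  | zero => simpa using by positivity
  | succ k =>
    have hind : ‖∑ i ∈ Finset.range (k + 1), s i • z (φ i)‖ ≤
        ‖z (φ 0)‖ + R + ∑ i ∈ Finset.range k, (1 / 2 : ℝ) ^ i := by
      induction k with
      | zero => rcases hs 0 with h0 | h0 <;> simp [h0, hR]
      | succ k ih =>
        rw [Finset.sum_range_succ, add_comm (∑ _ ∈ _, _),
          Finset.sum_range_succ (fun i => (1 / 2 : ℝ) ^ i)]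
        refine (h k _ (sum_mem_signedSums z hφ hs k) _ (hs _)).trans ?_
        have hpos : 0 ≤ ∑ i ∈ Finset.range k, (1 / 2 : ℝ) ^ i :=
          Finset.sum_nonneg fun _ _ => by positivity
        have : max ‖∑ i ∈ Finset.range (k + 1), s i • z (φ i)‖ R ≤
            ‖z (φ 0)‖ + R + ∑ i ∈ Finset.range k, (1 / 2 : ℝ) ^ i :=
          max_le ih (by linarith [norm_nonneg (z (φ 0))])
        linarith
    linarith [sum_geometric_two_le k]

lemma exists_weakStarNull_sub [TopologicalSpace.SeparableSpace X] {f : ℕ → X →L[ℝ] ℝ}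
    (hf : ∀ n, ‖f n‖ ≤ 1) : ∃ (f₀ : X →L[ℝ] ℝ) (ψ : ℕ → ℕ), ‖f₀‖ ≤ 1 ∧ StrictMono ψ ∧
      WeakStarNull fun n => f (ψ n) - f₀ := by
  obtain ⟨f₀, h₀, ψ, hψ, hlim⟩ := WeakDual.isSeqCompact_closedBall (𝕜 := ℝ) (E := X) 0 1
    (x := fun n => StrongDual.toWeakDual (f n)) (fun n => by simpa using hf n)
  refine ⟨WeakDual.toStrongDual f₀, ψ, by simpa using h₀, hψ, fun x => ?_⟩
  have h := (((WeakDual.eval_continuous (𝕜 := ℝ) x).tendsto f₀).comp hlim).sub_const (f₀ x)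
  rw [sub_self] at h
  exact h

lemma embedsIso_c0_of_weakNull [CompleteSpace X] (hM : PropertyM X) {z : ℕ → X}
    (hz : WeakNull z) {y : X} (hy : y ≠ 0)
    (hzy : Tendsto (fun n => ‖z n + y‖) atTop (𝓝 ‖y‖)) {g : ℕ → X →L[ℝ] ℝ} {K δ : ℝ}
    (hK : 0 < K) (hgK : ∀ n, ‖g n‖ ≤ K) (hg : WeakStarNull g) (hδ : 0 < δ)
    (hgz : ∀ᶠ n in atTop, δ ≤ |g n (z n)|) : EmbedsIso C₀(ℕ, ℝ) X := by
  let Q : ℕ → ℕ → Prop := fun N n => N < n ∧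
    (∀ u ∈ signedSums z (N + 1), ‖z n + u‖ ≤ max ‖u‖ ‖y‖ + (1 / 2) ^ N ∧
      ‖z n + -u‖ ≤ max ‖-u‖ ‖y‖ + (1 / 2) ^ N) ∧
    ∀ i ∈ Finset.range (N + 1), |g i (z n)| < δ / 8 * (1 / 2) ^ N ∧
      |g n (z i)| < δ / 8 * (1 / 2) ^ N
  have hQ : ∀ N, ∀ᶠ n in atTop, Q N n := by
    intro N
    have hN : (0 : ℝ) < (1 / 2) ^ N := by positivity
    refine (eventually_gt_atTop N).and (Eventually.and ?_ ?_)
    · refine (finite_signedSums z (N + 1)).eventually_all.2 fun u _ => ?_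
      exact ((hM.eventually_norm_add_lt hz hy hzy u hN).mono fun _ h => h.le).and
        ((hM.eventually_norm_add_lt hz hy hzy (-u) hN).mono fun _ h => h.le)
    · refine (Finset.eventually_all _).2 fun i _ => ?_
      have hpos : |(0 : ℝ)| < δ / 8 * (1 / 2) ^ N := by rw [abs_zero]; positivity
      exact ((hz (g i)).abs.eventually_lt_const hpos).and
        ((hg (z i)).abs.eventually_lt_const hpos)
  obtain ⟨φ, hP, hφQ⟩ := exists_seq_of_forall_finset_exists (fun n => δ ≤ |g n (z n)|) Q
    fun s _ => (hgz.and ((Finset.eventually_all s).2 fun N _ => hQ N)).exists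
  have hφ : StrictMono φ := fun m n h => (hφQ m n h).1
  have hpow : ∀ {k n : ℕ}, k ≤ n → (1 / 2 : ℝ) ^ φ n ≤ (1 / 2) ^ k := fun {k n} h =>
    pow_le_pow_of_le_one (by norm_num) (by norm_num) (h.trans (hφ.id_le n))
  have hsign : ∀ k, ∀ u ∈ signedSums z (φ k + 1), ∀ s : ℝ, (s = 1 ∨ s = -1) →
      ‖s • z (φ (k + 1)) + u‖ ≤ max ‖u‖ ‖y‖ + (1 / 2) ^ k := by
    intro k u hu s hs
    obtain ⟨h1, h2⟩ := (hφQ k (k + 1) k.lt_succ_self).2.1 u hu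
    have hle := hpow (le_refl k)
    rcases hs with rfl | rfl
    · rw [one_smul]; linarith
    · rw [norm_neg] at h2
      rw [← norm_neg, show -((-1 : ℝ) • z (φ (k + 1)) + u) = z (φ (k + 1)) + -u by simp [add_comm]]
      linarith
  refine embedsIso_c0_of_sign_sums (w := fun i => z (φ i)) (g := fun i => g (φ i))
    (a := fun i => δ / 4 * (1 / 2) ^ i) (norm_sign_sum_le hφ (norm_nonneg y) hsign) hK
    (fun k => hgK _) hP (fun i => by positivity) (hasSum_geometric_two.mul_left (δ / 4))
    (by linarith) fun k i hik => ?_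
  rcases lt_or_gt_of_ne hik with h | h
  · refine ((hφQ i k h).2.2 (φ i) (by simp)).2.le.trans ?_
    have := hpow (le_refl i)
    gcongr ?_ * ?_
    linarith
  · obtain ⟨j, rfl⟩ : ∃ j, i = j + 1 := Nat.exists_eq_succ_of_ne_zero (by omega)
    have hkj : φ k ≤ φ j := hφ.monotone (by omega)
    refine ((hφQ j (j + 1) j.lt_succ_self).2.2 (φ k) (by simp; omega)).1.le.trans ?_
    have := mul_le_mul_of_nonneg_left (hpow (le_refl j)) (by positivity : 0 ≤ δ / 8)
    rw [pow_succ]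
    linarith

end

theorem stmt2 (X : Type*) [NormedAddCommGroup X] [NormedSpace ℝ X] [CompleteSpace X]
    [TopologicalSpace.SeparableSpace X]
    (hM : PropertyM X) (hc : ¬ EmbedsIso C₀(ℕ, ℝ) X) :
    KadecKlee X := by
  by_contra hKK
  simp only [KadecKlee, not_forall] at hKK
  obtain ⟨x, y, hweak, hnorm, hnot⟩ := hKK
  have hy : y ≠ 0 := by
    rintro rfl
    exact hnot (by simpa using hnorm)
  obtain ⟨δ, hδ, hfreq⟩ : ∃ δ > 0, ∃ᶠ n in atTop, δ ≤ ‖x n - y‖ := by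
    by_contra! h
    refine hnot (Metric.tendsto_nhds.2 fun ε hε => ?_)
    filter_upwards [h ε hε] with n hn
    simpa using hn
  obtain ⟨φ, hφ, hφδ⟩ := extraction_of_frequently_atTop hfreq
  choose f hf1 hf using fun n => exists_dual_vector'' ℝ (x (φ n) - y)
  obtain ⟨f₀, ψ, hf₀, hψ, hlim⟩ := exists_weakStarNull_sub hf1
  have hφψ : Tendsto (fun n => φ (ψ n)) atTop atTop := hφ.tendsto_atTop.comp hψ.tendsto_atTop
  have hz : WeakNull fun n => x (φ (ψ n)) - y := fun h => by
    simpa using ((hweak h).comp hφψ).sub_const (h y)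
  refine hc (embedsIso_c0_of_weakNull hM hz hy ?_ (K := 2) (δ := δ / 2) two_pos (fun n => ?_)
    hlim (half_pos hδ) ?_)
  · simpa [Function.comp_def] using hnorm.comp hφψ
  · exact (norm_sub_le _ _).trans (by linarith [hf1 (ψ n)])
  · filter_upwards [(hz f₀).eventually_lt_const (half_pos hδ)] with n hn
    have h1 : f (ψ n) (x (φ (ψ n)) - y) = ‖x (φ (ψ n)) - y‖ := by simpa using hf (ψ n)
    refine le_trans ?_ (le_abs_self _)
    rw [sub_apply, h1]
    linarith [hφδ (ψ n)]
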